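/- Let (s,t) be an edge with s<t. In any execution of the algorithm, node s executes the rule Seduction(t) at most 2Δ+3 times. -/

import Mathlib

/-!
Formal model of the self-stabilizing maximal-matching algorithm in the
link-register model under read/write atomicity.

Nodes form a finite simple graph `G` on a vertex type `V` whose linear order
plays the role of the distinct identifiers.  A configuration records, for each
node `u`, its pointer `p u : Option V` (`none` = null), its lock variable
`m u : Fin 3`, and for each (directed) link a register `r u v : RegFlag × Fin 3`.
-/

inductive RegFlag where
  | Idle | You | Other
deriving DecidableEq

abbrev RegVal : Type := RegFlag × Fin 3

inductive Rule (V : Type) where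
  | write (a : V)
  | seduction (a : V)
  | marriage (a : V)
  | increase
  | reset
deriving DecidableEq

structure Config (V : Type) where
  p : V → Option V
  m : V → Fin 3
  r : V → V → RegVal

variable {V : Type}

def correctRegisterValue [DecidableEq V] (C : Config V) (u a : V) : RegVal :=
  match C.p u with
  | none => (RegFlag.Idle, 0)
  | some b => if b = a then (RegFlag.You, C.m u) else (RegFlag.Other, C.m u)

def PRabandonment [LinearOrder V] (C : Config V) (u : V) : Prop :=
  ∃ v, C.p u = some v ∧
    (((C.r v u).1 ≠ RegFlag.You ∧ (v < u ∨ C.m u ≠ 0)) ∨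
     (C.r v u = (RegFlag.Other, 2) ∧ u < v))

def PRreset [LinearOrder V] (C : Config V) (u : V) : Prop :=
  ∃ v, C.p u = some v ∧ (C.r v u).1 = RegFlag.You ∧
    ((C.m u = 0 ∧ (C.r v u).2 = 2) ∨
     (C.m u = 2 ∧ (C.r v u).2 = 0) ∨
     (C.m u = 0 ∧ (C.r v u).2 = 1 ∧ v < u) ∨
     (C.m u = 1 ∧ (C.r v u).2 = 0 ∧ u < v) ∨
     (C.m u = 1 ∧ (C.r v u).2 = 2 ∧ u < v) ∨
     (C.m u = 2 ∧ (C.r v u).2 = 1 ∧ v < u))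

/-- The guard of each rule of node `u` in configuration `C`. -/
def eligible [LinearOrder V] (G : SimpleGraph V) (C : Config V) (u : V) : Rule V → Prop
  | .write a => G.Adj u a ∧ C.r u a ≠ correctRegisterValue C u a
  | .seduction a => G.Adj u a ∧ C.p u = none ∧ C.r u a = correctRegisterValue C u a ∧
      C.r a u = (RegFlag.Idle, 0) ∧ u < a
  | .marriage a => G.Adj u a ∧ C.p u = none ∧ C.r u a = correctRegisterValue C u a ∧
      C.r a u = (RegFlag.You, 0) ∧ a < u
  | .increase => ∃ v, C.p u = some v ∧ C.r u v = correctRegisterValue C u v ∧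
      (C.r v u).1 = RegFlag.You ∧
      ((C.m u = 0 ∧ ((u < v ∧ (C.r v u).2 = 1) ∨ (v < u ∧ (C.r v u).2 = 0))) ∨
       (C.m u = 1 ∧ ((u < v ∧ (C.r v u).2 = 1) ∨ (v < u ∧ (C.r v u).2 = 2))))
  | .reset => ∃ v, C.p u = some v ∧ C.r u v = correctRegisterValue C u v ∧
      (PRabandonment C u ∨ PRreset C u)

/-- Simultaneous application of (at most) one rule per node.  `A u = some R`
means node `u` executes rule `R`; each action only modifies the data owned by
the acting node. -/
def step [DecidableEq V] (C : Config V) (A : V → Option (Rule V)) : Config V where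
  p u :=
    match A u with
    | some (Rule.seduction a) => some a
    | some (Rule.marriage a) => some a
    | some Rule.reset => none
    | _ => C.p u
  m u :=
    match A u with
    | some (Rule.seduction _) => 0
    | some (Rule.marriage _) => 0
    | some Rule.reset => 0
    | some Rule.increase => C.m u + 1
    | _ => C.m u
  r u a :=
    match A u with
    | some (Rule.write b) => if a = b then correctRegisterValue C u a else C.r u a
    | _ => C.r u a

/-- An execution `C_0, A_0, C_1, A_1, …, C_T`: at each transition `i < T`, a
nonempty set of eligible rules (at most one per node) is executed
simultaneously. -/
structure Execution [LinearOrder V] (G : SimpleGraph V) where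
  T : ℕ
  conf : ℕ → Config V
  act : ℕ → V → Option (Rule V)
  act_nonempty : ∀ i < T, ∃ u, (act i u).isSome
  act_eligible : ∀ i < T, ∀ u R, act i u = some R → eligible G (conf i) u R
  conf_succ : ∀ i < T, conf (i + 1) = step (conf i) (act i)

/-- A configuration is stable if no rule is eligible at any node. -/
def stableConfig [LinearOrder V] (G : SimpleGraph V) (C : Config V) : Prop :=
  ∀ u R, ¬ eligible G C u R

/-- The edge `(s,t)` (with `s < t` intended) is in state `(You, α, β)`. -/
def edgeState (C : Config V) (s t : V) (α β : Fin 3) : Prop :=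
  C.p s = some t ∧ C.p t = some s ∧ C.m s = α ∧ C.m t = β

def updatedCorrectState (C : Config V) (s t : V) (α β : Fin 3) : Prop :=
  edgeState C s t α β ∧ C.r s t = (RegFlag.You, α) ∧ C.r t s = (RegFlag.You, β) ∧
    ((α, β) = ((0 : Fin 3), (0 : Fin 3)) ∨ (α, β) = (0, 1) ∨ (α, β) = (1, 1) ∨
     (α, β) = (2, 1) ∨ (α, β) = (2, 2))

def toUpdateCorrectState (C : Config V) (s t : V) (α β : Fin 3) : Prop :=
  edgeState C s t α β ∧
    ((((α, β) = ((0 : Fin 3), (1 : Fin 3)) ∨ (α, β) = (2, 2)) ∧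
        C.r s t = (RegFlag.You, α) ∧ C.r t s = (RegFlag.You, β - 1)) ∨
     (((α, β) = ((1 : Fin 3), (1 : Fin 3)) ∨ (α, β) = (2, 1)) ∧
        C.r s t = (RegFlag.You, α - 1) ∧ C.r t s = (RegFlag.You, β)))

def correctState (C : Config V) (s t : V) (α β : Fin 3) : Prop :=
  updatedCorrectState C s t α β ∨ toUpdateCorrectState C s t α β

/-- Node `u` executes a `v`-rule in transition `k`: one of `Write(v)`,
`Seduction(v)`, `Marriage(v)`, a `v`-`Increase` or a `v`-`Reset`. -/
def execVRule [LinearOrder V] {G : SimpleGraph V} (E : Execution G) (k : ℕ) (u v : V) : Prop :=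
  k < E.T ∧
    (E.act k u = some (Rule.write v) ∨ E.act k u = some (Rule.seduction v) ∨
     E.act k u = some (Rule.marriage v) ∨
     ((E.act k u = some Rule.increase ∨ E.act k u = some Rule.reset) ∧
       (E.conf k).p u = some v))


/-! Local description of one transition, seen from node `u` and its register towards `a`. -/

theorem crv_none [DecidableEq V] (C : Config V) (u a : V) (h : C.p u = none) :
    correctRegisterValue C u a = (RegFlag.Idle, 0) := by
  simp [correctRegisterValue, h]

theorem crv_self [DecidableEq V] (C : Config V) (u a : V) (h : C.p u = some a) :
    correctRegisterValue C u a = (RegFlag.You, C.m u) := by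
  simp [correctRegisterValue, h]

theorem crv_other [DecidableEq V] (C : Config V) (u a b : V) (h : C.p u = some b) (hb : b ≠ a) :
    correctRegisterValue C u a = (RegFlag.Other, C.m u) := by
  simp [correctRegisterValue, h, hb]

/-- What a transition may do to `p u`, `m u` and the register `r u a`. -/
def NodeTrans [LinearOrder V] (C C' : Config V) (A : V → Option (Rule V)) (u a : V) : Prop :=
  (C'.p u = C.p u ∧ C'.m u = C.m u ∧ C'.r u a = C.r u a) ∨
  (C'.p u = C.p u ∧ C'.m u = C.m u ∧ C'.r u a = correctRegisterValue C u a ∧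
    A u = some (Rule.write a)) ∨
  (∃ b, C.p u = none ∧ C'.p u = some b ∧ C'.m u = 0 ∧ C'.r u a = C.r u a ∧
    C.r u b = (RegFlag.Idle, 0) ∧
    ((A u = some (Rule.seduction b) ∧ C.r b u = (RegFlag.Idle, 0) ∧ u < b) ∨
     (A u = some (Rule.marriage b) ∧ C.r b u = (RegFlag.You, 0) ∧ b < u))) ∨
  (∃ v, C.p u = some v ∧ C'.p u = some v ∧ C'.r u a = C.r u a ∧
    C.r u v = (RegFlag.You, C.m u) ∧
      ((C.m u = 0 ∧ C'.m u = 1 ∧ ((u < v ∧ C.r v u = (RegFlag.You, 1)) ∨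
          (v < u ∧ C.r v u = (RegFlag.You, 0)))) ∨
       (C.m u = 1 ∧ C'.m u = 2 ∧ ((u < v ∧ C.r v u = (RegFlag.You, 1)) ∨
          (v < u ∧ C.r v u = (RegFlag.You, 2)))))) ∨
  (∃ v, C.p u = some v ∧ C'.p u = none ∧ C'.m u = 0 ∧ C'.r u a = C.r u a ∧
    A u = some Rule.reset ∧
    C.r u v = (RegFlag.You, C.m u) ∧
    (((C.r v u).1 ≠ RegFlag.You ∧ (v < u ∨ C.m u ≠ 0)) ∨
     (C.r v u = (RegFlag.Other, 2) ∧ u < v) ∨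
     (C.m u = 0 ∧ C.r v u = (RegFlag.You, 2)) ∨
     (C.m u = 2 ∧ C.r v u = (RegFlag.You, 0)) ∨
     (C.m u = 0 ∧ C.r v u = (RegFlag.You, 1) ∧ v < u) ∨
     (C.m u = 1 ∧ C.r v u = (RegFlag.You, 0) ∧ u < v) ∨
     (C.m u = 1 ∧ C.r v u = (RegFlag.You, 2) ∧ u < v) ∨
     (C.m u = 2 ∧ C.r v u = (RegFlag.You, 1) ∧ v < u)))

theorem exec_trans [LinearOrder V] {G : SimpleGraph V} (E : Execution G) (i : ℕ) (hi : i < E.T)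
    (u a : V) : NodeTrans (E.conf i) (E.conf (i + 1)) (E.act i) u a := by
  have he := E.act_eligible i hi u
  rw [E.conf_succ i hi]
  generalize E.conf i = C at *
  unfold NodeTrans
  rcases hA : E.act i u with _ | R
  · left; simp [step, hA]
  · have h := he R hA
    cases R with
    | write b =>
      by_cases hab : a = b
      · subst hab
        right; left
        simp [step, hA]
      · left; simp [step, hA, hab]
    | seduction b =>
      right; right; left
      obtain ⟨_, h1, h2, h3, h4⟩ := h
      rw [crv_none C u b h1] at h2
      exact ⟨b, h1, by simp [step, hA], by simp [step, hA], by simp [step, hA], h2,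
        Or.inl ⟨rfl, h3, h4⟩⟩
    | marriage b =>
      right; right; left
      obtain ⟨_, h1, h2, h3, h4⟩ := h
      rw [crv_none C u b h1] at h2
      exact ⟨b, h1, by simp [step, hA], by simp [step, hA], by simp [step, hA], h2,
        Or.inr ⟨rfl, h3, h4⟩⟩
    | increase =>
      right; right; right; left
      obtain ⟨v, h1, h2, h3, h4⟩ := h
      rw [crv_self C u v h1] at h2
      refine ⟨v, h1, by simp [step, hA, h1], by simp [step, hA], h2, ?_⟩
      have hm : (step C (E.act i)).m u = C.m u + 1 := by simp [step, hA]
      rw [hm]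
      generalize C.r v u = z at *
      obtain ⟨z1, z2⟩ := z
      simp only at h3 h4
      subst h3
      rcases h4 with ⟨h5, h6⟩ | ⟨h5, h6⟩ <;> rw [h5] <;> simpa using h6
    | reset =>
      right; right; right; right
      obtain ⟨v, h1, h2, h3⟩ := h
      rw [crv_self C u v h1] at h2
      refine ⟨v, h1, by simp [step, hA], by simp [step, hA], by simp [step, hA], rfl, h2, ?_⟩
      rcases h3 with ⟨v', hv, h3⟩ | ⟨v', hv, h3, h4⟩
      · rw [h1] at hv; cases hv
        tauto
      · rw [h1] at hv; cases hv
        generalize C.r v u = z at *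
        obtain ⟨z1, z2⟩ := z
        simp only at h3 h4
        subst h3
        simp only [Prod.mk.injEq, true_and]
        tauto

/-- Pointer discipline invariant. -/
def YY (C : Config V) (s t : V) : Prop :=
  C.p t = some s → C.m t ≠ 0 → (C.r t s).1 = RegFlag.You

def II (C : Config V) (s t : V) : Prop :=
  C.p s = some t ∧ C.m s = 0 ∧ C.r t s ≠ (RegFlag.You, 1) ∧ C.r t s ≠ (RegFlag.You, 2) ∧
    (C.p t = some s → C.m t = 0)

def Locked (C : Config V) (s t : V) : Prop :=
  C.p s = some t ∧ C.p t = some s ∧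
  ((C.m s = 0 ∧ C.m t = 1 ∧ C.r s t = (RegFlag.You, 0) ∧ C.r t s = (RegFlag.You, 0)) ∨
   (C.m s = 0 ∧ C.m t = 1 ∧ C.r s t = (RegFlag.You, 0) ∧ C.r t s = (RegFlag.You, 1)) ∨
   (C.m s = 1 ∧ C.m t = 1 ∧ C.r s t = (RegFlag.You, 0) ∧ C.r t s = (RegFlag.You, 1)) ∨
   (C.m s = 1 ∧ C.m t = 1 ∧ C.r s t = (RegFlag.You, 1) ∧ C.r t s = (RegFlag.You, 1)) ∨
   (C.m s = 2 ∧ C.m t = 1 ∧ C.r s t = (RegFlag.You, 1) ∧ C.r t s = (RegFlag.You, 1)) ∨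
   (C.m s = 2 ∧ C.m t = 1 ∧ C.r s t = (RegFlag.You, 2) ∧ C.r t s = (RegFlag.You, 1)) ∨
   (C.m s = 2 ∧ C.m t = 2 ∧ C.r s t = (RegFlag.You, 2) ∧ C.r t s = (RegFlag.You, 1)) ∨
   (C.m s = 2 ∧ C.m t = 2 ∧ C.r s t = (RegFlag.You, 2) ∧ C.r t s = (RegFlag.You, 2)))

theorem fin3_cases (x : Fin 3) : x = 0 ∨ x = 1 ∨ x = 2 := by
  fin_cases x <;> simp

theorem YY_step [LinearOrder V] {C C' : Config V} {A : V → Option (Rule V)} {s t : V}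
    (ht : NodeTrans C C' A t s) (h : YY C s t) : YY C' s t := by
  have h1 := crv_self C t s
  unfold YY at *
  unfold NodeTrans at ht
  rcases ht with ht | ht | ht | ht | ht <;> grind

theorem Locked_step [LinearOrder V] {C C' : Config V} {A : V → Option (Rule V)} {s t : V}
    (hst : s < t) (hs : NodeTrans C C' A s t) (ht : NodeTrans C C' A t s) (h : Locked C s t) :
    Locked C' s t := by
  have hts : ¬ t < s := not_lt_of_gt hst
  obtain ⟨h1, h2, h3⟩ := h
  have h4 := crv_self C t s h2
  have h5 := crv_self C s t h1
  unfold Locked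
  unfold NodeTrans at hs ht
  rw [h4] at ht
  rw [h5] at hs
  simp only [h1, h2, reduceCtorEq, false_and, exists_false, Option.some.injEq,
    false_or, exists_eq_left', hts, hst, true_and, or_false, and_true, and_false] at hs ht ⊢
  rcases h3 with h3 | h3 | h3 | h3 | h3 | h3 | h3 | h3 <;> obtain ⟨e1, e2, e3, e4⟩ := h3 <;>
    simp [e1, e2, e3, e4] at hs ht ⊢ <;> casesm* _ ∨ _, _ ∧ _ <;> simp_all

theorem II_step [LinearOrder V] {C C' : Config V} {A : V → Option (Rule V)} {s t : V}
    (hst : s < t) (hs : NodeTrans C C' A s t) (ht : NodeTrans C C' A t s) (h : II C s t) :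
    II C' s t ∨ Locked C' s t ∨ (C'.p s ≠ some t ∧ C.r t s = (RegFlag.Other, 2)) := by
  have hts : ¬ t < s := not_lt_of_gt hst
  obtain ⟨h1, h2, h3, h3', h4⟩ := h
  have h5 := crv_self C s t h1
  have h6 := crv_self C t s
  have h7 := crv_none C t s
  have h8 := crv_other C t s
  have hs' : (C'.p s = some t ∧ C'.m s = 0 ∧ (C'.r s t = C.r s t ∨ C'.r s t = (RegFlag.You, 0))) ∨
      (C'.p s ≠ some t ∧ C.r t s = (RegFlag.Other, 2)) := by
    unfold NodeTrans at hs
    rw [h5] at hs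
    simp only [h1, h2, reduceCtorEq, false_and, exists_false, Option.some.injEq,
      false_or, exists_eq_left', hts, hst, true_and, or_false, and_true, and_false] at hs ⊢
    grind
  rcases hs' with ⟨a1, a2, a3⟩ | hs'
  · have ht' : (C'.r t s ≠ (RegFlag.You, 1) ∧ C'.r t s ≠ (RegFlag.You, 2) ∧
        (C'.p t = some s → C'.m t = 0)) ∨ (C'.p t = some s ∧ C'.m t = 1 ∧
          C'.r t s = (RegFlag.You, 0) ∧ C.r s t = (RegFlag.You, 0)) := by
      have hcr : correctRegisterValue C t s ≠ (RegFlag.You, 1) ∧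
        correctRegisterValue C t s ≠ (RegFlag.You, 2) := by
        cases hp : C.p t with
        | none => rw [h7 hp]; simp
        | some b =>
          by_cases hb : b = s
          · subst hb; rw [h6 hp, h4 hp]; simp
          · rw [h8 b hp hb]; simp
      unfold NodeTrans at ht
      rcases ht with ht | ht | ht | ht | ht <;> grind
    unfold II Locked
    grind
  · exact Or.inr (Or.inr hs')

theorem sed_step [LinearOrder V] {C C' : Config V} {A : V → Option (Rule V)} {s t : V}
    (hst : s < t) (hs : NodeTrans C C' A s t) (ht : NodeTrans C C' A t s) (hY : YY C s t)
    (h : C.p s ≠ some t) : C'.p s ≠ some t ∨ II C' s t := by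
  have hts : ¬ t < s := not_lt_of_gt hst
  by_cases h' : C'.p s = some t
  · right
    have hh : C'.m s = 0 ∧ C.r t s = (RegFlag.Idle, 0) := by
      unfold NodeTrans at hs
      grind
    obtain ⟨h1, h2⟩ := hh
    have h6 := crv_self C t s
    have h7 := crv_none C t s
    have h8 := crv_other C t s
    have h4 : C.p t = some s → C.m t = 0 := by
      intro h4
      by_contra h5
      have := hY h4 h5
      simp [h2] at this
    have hcr : correctRegisterValue C t s ≠ (RegFlag.You, 1) ∧
        correctRegisterValue C t s ≠ (RegFlag.You, 2) := by
      cases hp : C.p t with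
      | none => rw [h7 hp]; simp
      | some b =>
        by_cases hb : b = s
        · subst hb; rw [h6 hp, h4 hp]; simp
        · rw [h8 b hp hb]; simp
    unfold II
    unfold NodeTrans at ht
    rcases ht with ht | ht | ht | ht | ht <;> grind
  · left; exact (by assumption)

/-- The combined invariant. -/
def ZZ (C : Config V) (s t : V) : Prop :=
  YY C s t ∧ (II C s t ∨ Locked C s t ∨ C.p s ≠ some t)

/-- Generic induction along an execution segment. -/
theorem seg_induct {P : ℕ → Prop} {T a b : ℕ} (hb : b ≤ T) (hab : a ≤ b) (h0 : P a)
    (hs : ∀ i, a ≤ i → i < b → i < T → P i → P (i + 1)) : P b := by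
  induction b, hab using Nat.le_induction with
  | base => exact h0
  | succ n hn ih =>
    exact hs n hn (by omega) (by omega) (ih (by omega) (fun i h1 h2 h3 => hs i h1 (by omega) h3))

section
variable [LinearOrder V] {G : SimpleGraph V} (E : Execution G)

theorem YY_seg {s t : V} {a b : ℕ} (hb : b ≤ E.T) (hab : a ≤ b) (h : YY (E.conf a) s t) :
    YY (E.conf b) s t :=
  seg_induct (P := fun i => YY (E.conf i) s t) hb hab h
    (fun i _ _ hi h => YY_step (exec_trans E i hi t s) h)

theorem Locked_seg {s t : V} (hst : s < t) {a b : ℕ} (hb : b ≤ E.T) (hab : a ≤ b)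
    (h : Locked (E.conf a) s t) : Locked (E.conf b) s t :=
  seg_induct (P := fun i => Locked (E.conf i) s t) hb hab h
    (fun i _ _ hi h => Locked_step hst (exec_trans E i hi s t) (exec_trans E i hi t s) h)

theorem ZZ_seg {s t : V} (hst : s < t) {a b : ℕ} (hb : b ≤ E.T) (hab : a ≤ b)
    (h : ZZ (E.conf a) s t) : ZZ (E.conf b) s t := by
  refine seg_induct (P := fun i => ZZ (E.conf i) s t) hb hab h ?_
  rintro i _ _ hi ⟨hY, hQ⟩
  have hs := exec_trans E i hi s t
  have ht := exec_trans E i hi t s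
  refine ⟨YY_step ht hY, ?_⟩
  rcases hQ with h | h | h
  · rcases II_step hst hs ht h with h | h | h
    · exact Or.inl h
    · exact Or.inr (Or.inl h)
    · exact Or.inr (Or.inr h.1)
  · exact Or.inr (Or.inl (Locked_step hst hs ht h))
  · rcases sed_step hst hs ht hY h with h | h
    · exact Or.inr (Or.inr h)
    · exact Or.inl h

/-- At every `Seduction(t)` of `s` but the first, the invariant `YY` holds. -/
theorem YY_second {s t : V} (hst : s < t) {i j : ℕ} (hj : j < E.T) (hij : i < j)
    (hi : E.act i s = some (Rule.seduction t)) (hj' : E.act j s = some (Rule.seduction t)) :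
    YY (E.conf j) s t := by
  have hts : ¬ t < s := not_lt_of_gt hst
  have hiT : i < E.T := by omega
  have key : YY (E.conf j) s t ∨ ((E.conf j).p s = some t ∧ (E.conf j).m s = 0 ∧
      (E.conf j).r t s = (RegFlag.Idle, 0) ∧ (E.conf j).p t = some s ∧ (E.conf j).m t ≠ 0) := by
    refine seg_induct (P := fun j => YY (E.conf j) s t ∨
      ((E.conf j).p s = some t ∧ (E.conf j).m s = 0 ∧
      (E.conf j).r t s = (RegFlag.Idle, 0) ∧ (E.conf j).p t = some s ∧ (E.conf j).m t ≠ 0))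
      (T := E.T) (a := i + 1) (by omega) (by omega) ?_ ?_
    · have ht := exec_trans E i hiT t s
      have he := E.act_eligible i hiT s _ hi
      obtain ⟨_, e1, e2, e3, e4⟩ := he
      have h6 := crv_self (E.conf i) t s
      by_cases hY : YY (E.conf i) s t
      · exact Or.inl (YY_step ht hY)
      · unfold YY at hY ⊢
        have n1 : (E.conf (i + 1)).p s = some t := by
          rw [E.conf_succ i hiT]; simp [step, hi]
        have n2 : (E.conf (i + 1)).m s = 0 := by
          rw [E.conf_succ i hiT]; simp [step, hi]
        unfold NodeTrans at ht
        rcases ht with ht | ht | ht | ht | ht <;> grind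
    · rintro k _ _ hk (h | ⟨h1, h2, h3, h4, h5⟩)
      · exact Or.inl (YY_step (exec_trans E k hk t s) h)
      · have hs := exec_trans E k hk s t
        have ht := exec_trans E k hk t s
        have h6 := crv_self (E.conf k) t s h4
        unfold YY
        unfold NodeTrans at hs ht
        rcases hs with hs | hs | hs | hs | hs <;> rcases ht with ht | ht | ht | ht | ht <;> grind
  rcases key with h | h
  · exact h
  · obtain ⟨_, e1, _⟩ := E.act_eligible j hj s _ hj'
    rw [e1] at h
    simp at h

/-- If a register acquires a value, it was written. -/
theorem written {u a : V} {v : RegVal} {i j : ℕ} (hj : j ≤ E.T) (hij : i ≤ j)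
    (hi : (E.conf i).r u a ≠ v) (hj' : (E.conf j).r u a = v) :
    ∃ w, i ≤ w ∧ w < j ∧ correctRegisterValue (E.conf w) u a = v ∧
      E.act w u = some (Rule.write a) := by
  by_contra hcon
  have : (E.conf j).r u a ≠ v := by
    refine seg_induct (P := fun j => (E.conf j).r u a ≠ v) hj hij hi ?_
    intro k hk1 hk2 hkT hk
    have ht := exec_trans E k hkT u a
    unfold NodeTrans at ht
    rcases ht with ht | ht | ht | ht | ht <;> grind
  exact this hj'

theorem born {u x : V} {i j : ℕ} (hj : j ≤ E.T) (hij : i ≤ j)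
    (hi : (E.conf i).p u = none) (hj' : (E.conf j).p u = some x) :
    ∃ k, i ≤ k ∧ k < j ∧ (E.act k u = some (Rule.seduction x) ∨
      E.act k u = some (Rule.marriage x)) ∧ (E.conf (k + 1)).m u = 0 ∧
      ∀ l, k < l → l ≤ j → (E.conf l).p u = some x := by
  induction j, hij using Nat.le_induction with
  | base => rw [hi] at hj'; cases hj'
  | succ n hn ih =>
    have ht := exec_trans E n (by omega) u u
    by_cases hp : (E.conf n).p u = some x
    · obtain ⟨k, h1, h2, h3, h3', h4⟩ := ih (by omega) hp
      refine ⟨k, h1, by omega, h3, h3', fun l hl1 hl2 => ?_⟩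
      rcases Nat.lt_or_ge n l with h | h
      · have : l = n + 1 := by omega
        rw [this]; exact hj'
      · exact h4 l hl1 h
    · refine ⟨n, hn, by omega, ?_, ?_, fun l hl1 hl2 => ?_⟩
      · unfold NodeTrans at ht; rcases ht with ht | ht | ht | ht | ht <;> grind
      · unfold NodeTrans at ht; rcases ht with ht | ht | ht | ht | ht <;> grind
      · have : l = n + 1 := by omega
        rw [this]; exact hj'

theorem crv_you {C : Config V} {u a : V} {m : Fin 3}
    (h : correctRegisterValue C u a = (RegFlag.You, m)) : C.p u = some a ∧ C.m u = m := by
  unfold correctRegisterValue at h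
  grind

theorem crv_oth {C : Config V} {u a : V} {m : Fin 3}
    (h : correctRegisterValue C u a = (RegFlag.Other, m)) : C.p u ≠ none ∧ C.m u = m := by
  unfold correctRegisterValue at h
  grind

theorem crv_idle {C : Config V} {u a : V} {m : Fin 3}
    (h : correctRegisterValue C u a = (RegFlag.Idle, m)) : C.p u = none := by
  unfold correctRegisterValue at h
  grind

/-- A locked edge prevents its ends from resetting. -/
theorem Locked_no_reset {s t u : V} (hst : s < t) {l : ℕ} (hl : l < E.T)
    (h : Locked (E.conf l) s t) (hu : u = s ∨ u = t) : E.act l u ≠ some Rule.reset := by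
  intro hr
  have h' := Locked_step hst (exec_trans E l hl s t) (exec_trans E l hl t s) h
  have hn : (E.conf (l + 1)).p u = none := by
    rw [E.conf_succ l hl]; simp [step, hr]
  obtain ⟨h1, h2, _⟩ := h'
  rcases hu with rfl | rfl <;> simp_all

/-- Between two non-first seductions, `t` resets from `m = 2`. -/
theorem between {s t : V} (hst : s < t) {i j : ℕ} (hj : j < E.T) (hij : i < j)
    (hi : E.act i s = some (Rule.seduction t)) (hj' : E.act j s = some (Rule.seduction t))
    (hY : YY (E.conf i) s t) :
    ∃ l, i < l ∧ l < j ∧ E.act l t = some Rule.reset ∧ (E.conf l).m t = 2 := by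
  have hiT : i < E.T := by omega
  obtain ⟨_, a1, a2, a3, _⟩ := E.act_eligible i hiT s _ hi
  obtain ⟨_, b1, b2, b3, _⟩ := E.act_eligible j hj s _ hj'
  have hk : ∃ k, i < k ∧ k < j ∧ (E.conf k).r t s = (RegFlag.Other, 2) := by
    by_contra hcon
    have : II (E.conf j) s t ∨ Locked (E.conf j) s t := by
      refine seg_induct (P := fun j => II (E.conf j) s t ∨ Locked (E.conf j) s t)
        (T := E.T) (a := i + 1) (by omega) (by omega) ?_ ?_
      · have hs := exec_trans E i hiT s t
        have ht := exec_trans E i hiT t s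
        rcases sed_step hst hs ht hY (by simp [a1]) with h | h
        · exfalso; apply h
          rw [E.conf_succ i hiT]; simp [step, hi]
        · exact Or.inl h
      · rintro k hk1 hk2 hkT (h | h)
        · rcases II_step hst (exec_trans E k hkT s t) (exec_trans E k hkT t s) h with h | h | h
          · exact Or.inl h
          · exact Or.inr h
          · exact absurd ⟨k, by omega, hk2, h.2⟩ hcon
        · exact Or.inr (Locked_step hst (exec_trans E k hkT s t) (exec_trans E k hkT t s) h)
    rcases this with h | h
    · have := h.1; rw [b1] at this; cases this
    · have := h.1; rw [b1] at this; cases this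
  obtain ⟨k, hk1, hk2, hk3⟩ := hk
  obtain ⟨w, w1, w2, w3, w4⟩ := written E (i := i) (j := k) (by omega) (by omega)
    (by rw [a3]; simp) hk3
  obtain ⟨w', x1, x2, x3, x4⟩ := written E (i := k) (j := j) (by omega) (by omega)
    (by rw [hk3]; simp) b3
  have hw := crv_oth w3
  have hwb := crv_idle x3
  by_contra hcon
  have : (E.conf w').p t ≠ none ∧ (E.conf w').m t = 2 := by
    refine seg_induct (P := fun j => (E.conf j).p t ≠ none ∧ (E.conf j).m t = 2)
        (T := E.T) (a := w) (by omega) (by omega) hw ?_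
    rintro l hl1 hl2 hlT ⟨h1, h2⟩
    have hnr : E.act l t ≠ some Rule.reset := by
      intro hr
      refine hcon ⟨l, ?_, by omega, hr, h2⟩
      rcases Nat.lt_or_ge w l with h | h
      · omega
      · have : l = w := by omega
        rw [this, w4] at hr; cases hr
    have ht := exec_trans E l hlT t s
    unfold NodeTrans at ht
    rcases ht with ht | ht | ht | ht | ht <;> grind
  exact this.1 hwb

/-- A married node reaching `m = 2` has seen the two register values. -/
theorem climb {x t : V} (hxt : x < t) {k l : ℕ} (hl : l ≤ E.T) (hkl : k < l)
    (h0 : (E.conf (k + 1)).m t = 0)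
    (hp : ∀ j, k < j → j ≤ l → (E.conf j).p t = some x) (h2 : (E.conf l).m t = 2) :
    ∃ a b, k < a ∧ a < b ∧ b < l ∧ (E.conf a).r x t = (RegFlag.You, 0) ∧
      (E.conf b).r x t = (RegFlag.You, 2) := by
  have htx : ¬ t < x := not_lt_of_gt hxt
  have key : (E.conf l).m t = 0 ∨ (∃ a, k < a ∧ a < l ∧ (E.conf a).r x t = (RegFlag.You, 0) ∧
      ((E.conf l).m t = 1 ∨ (∃ b, a < b ∧ b < l ∧ (E.conf b).r x t = (RegFlag.You, 2)))) := by
    refine seg_induct (P := fun l => (E.conf l).m t = 0 ∨ (∃ a, k < a ∧ a < l ∧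
      (E.conf a).r x t = (RegFlag.You, 0) ∧
      ((E.conf l).m t = 1 ∨ (∃ b, a < b ∧ b < l ∧ (E.conf b).r x t = (RegFlag.You, 2)))))
      (T := E.T) (a := k + 1) hl (by omega) (Or.inl h0) ?_
    intro i hi1 hi2 hiT h
    have ht := exec_trans E i hiT t x
    have hpi := hp i (by omega) (by omega)
    rcases h with h | ⟨a, ha1, ha2, ha3, h | ⟨b, hb1, hb2, hb3⟩⟩
    · have : (E.conf (i + 1)).m t = 0 ∨ ((E.conf (i + 1)).m t = 1 ∧
          (E.conf i).r x t = (RegFlag.You, 0)) := by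
        unfold NodeTrans at ht; rcases ht with ht | ht | ht | ht | ht <;> grind
      rcases this with h | h
      · exact Or.inl h
      · exact Or.inr ⟨i, by omega, by omega, h.2, Or.inl h.1⟩
    · have : (E.conf (i + 1)).m t = 0 ∨ (E.conf (i + 1)).m t = 1 ∨
          (E.conf i).r x t = (RegFlag.You, 2) := by
        unfold NodeTrans at ht; rcases ht with ht | ht | ht | ht | ht <;> grind
      rcases this with h | h | h
      · exact Or.inl h
      · exact Or.inr ⟨a, ha1, by omega, ha3, Or.inl h⟩
      · exact Or.inr ⟨a, ha1, by omega, ha3, Or.inr ⟨i, ha2, by omega, h⟩⟩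
    · exact Or.inr ⟨a, ha1, by omega, ha3, Or.inr ⟨b, hb1, by omega, hb3⟩⟩
  rw [h2] at key
  rcases key with h | ⟨a, ha1, ha2, ha3, h | ⟨b, hb1, hb2, hb3⟩⟩
  · exact absurd h (by decide)
  · exact absurd h (by decide)
  · exact ⟨a, b, ha1, hb1, hb2, ha3, hb3⟩

theorem act_reset_none {t : V} {l : ℕ} (hl : l < E.T) (h : E.act l t = some Rule.reset) :
    (E.conf (l + 1)).p t = none := by
  rw [E.conf_succ l hl]; simp [step, h]

/-- Two non-initial resets of `t` from `m = 2` cannot have the same pointer. -/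
theorem reset_unique {t x : V} {l0 l1 l2 : ℕ} (hl2 : l2 < E.T) (h01 : l0 ≤ l1) (h12 : l1 < l2)
    (h0 : (E.conf l0).p t = none)
    (r1 : E.act l1 t = some Rule.reset) (m1 : (E.conf l1).m t = 2)
    (p1 : (E.conf l1).p t = some x)
    (r2 : E.act l2 t = some Rule.reset) (m2 : (E.conf l2).m t = 2)
    (p2 : (E.conf l2).p t = some x) : False := by
  obtain ⟨k1, c1, c2, c3, c4, c5⟩ := born E (by omega) h01 h0 p1
  obtain ⟨k2, d1, d2, d3, d4, d5⟩ := born E (i := l1 + 1) (by omega) (by omega)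
    (act_reset_none E (by omega) r1) p2
  have hk1T : k1 < E.T := by omega
  have hk2T : k2 < E.T := by omega
  rcases c3 with c3 | c3
  · obtain ⟨_, _, _, _, htx⟩ := E.act_eligible k1 hk1T t _ c3
    rcases d3 with d3 | d3
    · have hY := YY_second E htx hk2T (by omega) c3 d3
      obtain ⟨_, e1, _⟩ := E.act_eligible k2 hk2T t _ d3
      have hZ : ZZ (E.conf k2) t x := ⟨hY, Or.inr (Or.inr (by simp [e1]))⟩
      obtain ⟨_, h | h | h⟩ := ZZ_seg E htx (b := l2) (by omega) (by omega) hZ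
      · have := h.2.1; rw [m2] at this; exact absurd this (by decide)
      · exact Locked_no_reset E htx hl2 h (Or.inl rfl) r2
      · exact h p2
    · obtain ⟨_, _, _, _, hxt⟩ := E.act_eligible k2 hk2T t _ d3
      exact absurd htx (not_lt_of_gt hxt)
  · obtain ⟨_, e1, _, _, hxt⟩ := E.act_eligible k1 hk1T t _ c3
    obtain ⟨a1, b1, f1, f2, f3, f4, f5⟩ := climb E hxt (by omega) c2 c4 c5 m1
    obtain ⟨a2, b2, g1, g2, g3, g4, g5⟩ := climb E hxt (by omega) d2 d4 d5 m2
    obtain ⟨v1, u1, u2, u3, _⟩ := written E (i := a1) (j := b1) (by omega) (by omega)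
      (by rw [f4]; simp) f5
    obtain ⟨w, u4, u5, u6, _⟩ := written E (i := b1) (j := a2) (by omega) (by omega)
      (by rw [f5]; simp) g4
    obtain ⟨v2, u7, u8, u9, _⟩ := written E (i := a2) (j := b2) (by omega) (by omega)
      (by rw [g4]; simp) g5
    have hv1 := crv_you u3
    have hw := crv_you u6
    have hv2 := crv_you u9
    have hz : ∃ z, v1 ≤ z ∧ z ≤ w ∧ (E.conf z).p x ≠ some t := by
      by_contra hcon
      push Not at hcon
      have : (E.conf w).m x = 2 := by
        refine seg_induct (P := fun j => (E.conf j).m x = 2)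
          (T := E.T) (a := v1) (by omega) (by omega) hv1.2 ?_
        intro i hi1 hi2 hiT hi
        have q1 := hcon i (by omega) (by omega)
        have q2 := hcon (i + 1) (by omega) (by omega)
        have ht := exec_trans E i hiT x t
        unfold NodeTrans at ht
        rcases ht with ht | ht | ht | ht | ht <;> grind
      rw [hw.2] at this
      exact absurd this (by decide)
    obtain ⟨z, z1, z2, z3⟩ := hz
    have hY1 : YY (E.conf k1) x t := by
      intro h; rw [e1] at h; cases h
    have hYz : YY (E.conf z) x t := YY_seg E (by omega) (by omega) hY1
    have hZ : ZZ (E.conf z) x t := ⟨hYz, Or.inr (Or.inr z3)⟩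
    obtain ⟨_, h | h | h⟩ := ZZ_seg E hxt (b := v2) (by omega) (by omega) hZ
    · have := h.2.1; rw [hv2.2] at this; exact absurd this (by decide)
    · exact Locked_no_reset E hxt hl2 (Locked_seg E hxt (by omega) (by omega) h) (Or.inr rfl) r2
    · exact h hv2.1

end

/-- The number of resets of `t` from `m = 2`. -/
theorem card_resets {V : Type} [Fintype V] [LinearOrder V] (G : SimpleGraph V)
    [DecidableRel G.Adj] (t : V) (E : Execution G) :
    ((Finset.range E.T).filter fun l => E.act l t = some Rule.reset ∧ (E.conf l).m t = 2).card ≤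
      G.maxDegree + 1 := by
  classical
  have hdeg := G.degree_le_maxDegree t
  have hcard : (Finset.insertNone (G.neighborFinset t)).card = G.degree t + 1 := by
    simp
  refine le_trans ?_ (hcard.le.trans (by omega))
  refine Finset.card_le_card_of_injOn
    (fun l => if ∃ l' ≤ l, (E.conf l').p t = none then (E.conf l).p t else none) ?_ ?_
  · intro l hl
    simp only [Finset.coe_filter, Finset.mem_range, Set.mem_setOf_eq] at hl
    obtain ⟨hlT, hr, hm⟩ := hl
    simp only [Finset.mem_coe, Finset.mem_insertNone]
    intro x hx
    split_ifs at hx with h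
    · obtain ⟨l', h1, h2⟩ := h
      have hx' : (E.conf l).p t = some x := hx
      obtain ⟨k, c1, c2, c3, _⟩ := born E (by omega) h1 h2 hx'
      rw [SimpleGraph.mem_neighborFinset]
      rcases c3 with c3 | c3
      · exact (E.act_eligible k (by omega) t _ c3).1
      · exact (E.act_eligible k (by omega) t _ c3).1
    · cases hx
  · have main : ∀ l1 l2, l1 < l2 → l2 < E.T → E.act l1 t = some Rule.reset →
        (E.conf l1).m t = 2 → E.act l2 t = some Rule.reset → (E.conf l2).m t = 2 →
        (if ∃ l' ≤ l1, (E.conf l').p t = none then (E.conf l1).p t else none) =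
        (if ∃ l' ≤ l2, (E.conf l').p t = none then (E.conf l2).p t else none) → False := by
      intro l1 l2 h12 hl2 r1 m1 r2 m2 heq
      have hx2 : ∃ l' ≤ l2, (E.conf l').p t = none :=
        ⟨l1 + 1, h12, act_reset_none E (by omega) r1⟩
      obtain ⟨x2, hp2, _⟩ := E.act_eligible l2 hl2 t _ r2
      rw [if_pos hx2, hp2] at heq
      split_ifs at heq with h
      obtain ⟨l0, h1, h2⟩ := h
      exact reset_unique E hl2 h1 h12 h2 r1 m1 heq r2 m2 hp2
    intro l1 h1 l2 h2 heq
    simp only [Finset.coe_filter, Finset.mem_range, Set.mem_setOf_eq] at h1 h2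
    rcases lt_trichotomy l1 l2 with h | h | h
    · exact (main l1 l2 h h2.1 h1.2.1 h1.2.2 h2.2.1 h2.2.2 heq).elim
    · exact h
    · exact (main l2 l1 h h1.1 h2.2.1 h2.2.2 h1.2.1 h1.2.2 heq.symm).elim

/-- For an edge `(s,t)` with `s < t`, in any execution node `s`
executes the rule `Seduction(t)` at most `2Δ + 3` times. -/
theorem stmt_2 {V : Type} [Fintype V] [LinearOrder V] (G : SimpleGraph V)
    [DecidableRel G.Adj] (s t : V) (hadj : G.Adj s t) (hst : s < t)
    (E : Execution G) :
    ((Finset.range E.T).filter fun i => E.act i s = some (Rule.seduction t)).card ≤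
      2 * G.maxDegree + 3 := by
  have hD := card_resets G t E
  set S := (Finset.range E.T).filter fun i => E.act i s = some (Rule.seduction t) with hS
  rcases S.eq_empty_or_nonempty with h | hne
  · rw [h]; simp
  · have hmin := Finset.min'_mem S hne
    have hlt : ∀ i ∈ S.erase (S.min' hne), S.min' hne < i := fun i hi =>
      Finset.min'_lt_of_mem_erase_min' S hne hi
    have hcard := Finset.card_erase_of_mem hmin
    have hle : (S.erase (S.min' hne)).card ≤
        ((Finset.range E.T).filter fun l =>
          E.act l t = some Rule.reset ∧ (E.conf l).m t = 2).card + 1 := by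
      refine Finset.card_le_of_interleaved ?_
      intro i hi j hj hij _
      have h0i := hlt i hi
      have hi' := Finset.mem_of_mem_erase hi
      have hj' := Finset.mem_of_mem_erase hj
      generalize S.min' hne = i0 at *
      simp only [hS, Finset.mem_filter, Finset.mem_range] at hi' hj' hmin
      have hY := YY_second E hst hi'.1 h0i hmin.2 hi'.2
      obtain ⟨l, q1, q2, q3, q4⟩ := between E hst hj'.1 hij hi'.2 hj'.2 hY
      exact ⟨l, by simp only [Finset.mem_filter, Finset.mem_range]; exact ⟨by omega, q3, q4⟩,
        q1, q2⟩
    omega
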